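/- Let X be a complex Banach space and let {S_h} be a bounded family of operators on X. Then the resolvent set r({S_h}) is an open subset of ℂ. More precisely, if λ ∈ r({S_h}) and {R_h} is an asymptotic resolvent of {S_h} at λ, then every μ ∈ ℂ with |μ − λ| · limsup_{h→0} ‖R_h‖ < 1 belongs to r({S_h}). -/

import Mathlib

open Filter Topology Finset

noncomputable section

/-- The filter of approach `h → 0` within the interval `(0,1]`. -/
def zeroFilter : Filter ℝ := nhdsWithin 0 (Set.Ioc 0 1)

variable {X : Type*} [NormedAddCommGroup X] [NormedSpace ℂ X]

/-- A family of operators `(0,1] ∋ h ↦ S h` is bounded if `sup_{h ∈ (0,1]} ‖S h‖ < ∞`. -/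
def BddFamily (S : ℝ → X →L[ℂ] X) : Prop :=
  ∃ M : ℝ, ∀ h ∈ Set.Ioc (0 : ℝ) 1, ‖S h‖ ≤ M

/-- The bracket `(T - S)^{[n]} = ∑_{k=0}^{n} (-1)^{n-k} C(n,k) T^k S^{n-k}`. -/
def qBr (T S : X →L[ℂ] X) (n : ℕ) : X →L[ℂ] X :=
  ∑ k ∈ Finset.range (n + 1), ((-1 : ℂ) ^ (n - k) * (n.choose k : ℂ)) • (T ^ k * S ^ (n - k))

/-- Two families are asymptotically quasinilpotent equivalent. -/
def AsympQNEquiv (S T : ℝ → X →L[ℂ] X) : Prop :=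
  Tendsto (fun n : ℕ =>
      (Filter.limsup (fun h => ‖qBr (S h) (T h) n‖) zeroFilter) ^ ((n : ℝ)⁻¹))
    atTop (𝓝 0) ∧
  Tendsto (fun n : ℕ =>
      (Filter.limsup (fun h => ‖qBr (T h) (S h) n‖) zeroFilter) ^ ((n : ℝ)⁻¹))
    atTop (𝓝 0)

/-- `R` is an asymptotic resolvent of the family `S` at `l`: a bounded family such that
`(l I - S_h) R_h → I` and `R_h (l I - S_h) → I` in norm as `h → 0`. -/
def IsAsympResolvent (S R : ℝ → X →L[ℂ] X) (l : ℂ) : Prop :=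
  BddFamily R ∧
  Tendsto (fun h => ‖(l • (1 : X →L[ℂ] X) - S h) * R h - 1‖) zeroFilter (𝓝 0) ∧
  Tendsto (fun h => ‖R h * (l • (1 : X →L[ℂ] X) - S h) - 1‖) zeroFilter (𝓝 0)

/-- The resolvent set of a family of operators. -/
def famResolvent (S : ℝ → X →L[ℂ] X) : Set ℂ :=
  {l : ℂ | ∃ R : ℝ → X →L[ℂ] X, IsAsympResolvent S R l}

/-- The spectrum of a family of operators. -/
def famSpectrum (S : ℝ → X →L[ℂ] X) : Set ℂ :=
  (famResolvent S)ᶜ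

instance zeroFilter_neBot : zeroFilter.NeBot := by
  rw [zeroFilter, ← mem_closure_iff_nhdsWithin_neBot, closure_Ioc zero_ne_one]
  exact ⟨le_rfl, zero_le_one⟩

theorem eventually_zeroFilter_of_forall {p : ℝ → Prop} (hp : ∀ h ∈ Set.Ioc (0 : ℝ) 1, p h) :
    ∀ᶠ h in zeroFilter, p h :=
  Filter.mem_of_superset self_mem_nhdsWithin hp

/-- If `‖A‖ ≤ q < 1`, then `1 + A` has a two-sided inverse of norm at most `(1 - q)⁻¹`. -/
theorem exists_inverse_one_add [CompleteSpace X] {A : X →L[ℂ] X} {q : ℝ} (hA : ‖A‖ ≤ q)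
    (hq : q < 1) :
    ∃ V : X →L[ℂ] X, (1 + A) * V = 1 ∧ V * (1 + A) = 1 ∧ ‖V‖ ≤ (1 - q)⁻¹ := by
  obtain ⟨u, hu⟩ : IsUnit (1 + A) := by
    have h := isUnit_one_sub_of_norm_lt_one (x := -A) (by rw [norm_neg]; linarith)
    rwa [sub_neg_eq_add] at h
  refine ⟨↑u⁻¹, by simp [← hu], by simp [← hu], ?_⟩
  have hV : (↑u⁻¹ : X →L[ℂ] X) = 1 - A * ↑u⁻¹ := by
    have h : (1 + A) * (↑u⁻¹ : X →L[ℂ] X) = 1 := by simp [← hu]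
    rw [add_mul, one_mul] at h
    exact eq_sub_of_add_eq h
  have hle : ‖(↑u⁻¹ : X →L[ℂ] X)‖ ≤ 1 + q * ‖(↑u⁻¹ : X →L[ℂ] X)‖ :=
    calc ‖(↑u⁻¹ : X →L[ℂ] X)‖ = ‖1 - A * (↑u⁻¹ : X →L[ℂ] X)‖ := by rw [← hV]
      _ ≤ ‖(1 : X →L[ℂ] X)‖ + ‖A * (↑u⁻¹ : X →L[ℂ] X)‖ := norm_sub_le _ _
      _ ≤ 1 + q * ‖(↑u⁻¹ : X →L[ℂ] X)‖ :=
        add_le_add ContinuousLinearMap.norm_id_le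
          ((norm_mul_le _ _).trans (mul_le_mul_of_nonneg_right hA (norm_nonneg _)))
  rw [inv_eq_one_div (1 - q), le_div_iff₀ (by linarith)]
  linarith

/-- Perturbing an asymptotic resolvent by a Neumann series. -/
theorem IsAsympResolvent.mem_famResolvent_of_eventually_le [CompleteSpace X]
    {S R : ℝ → X →L[ℂ] X} {l μ : ℂ} (hR : IsAsympResolvent S R l) {q : ℝ} (hq : q < 1)
    (hle : ∀ᶠ h in zeroFilter, ‖(μ - l) • R h‖ ≤ q) : μ ∈ famResolvent S := by
  obtain ⟨⟨M, hM⟩, hr, hl⟩ := hR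
  have hex : ∀ h, ∃ V : X →L[ℂ] X, ‖V‖ ≤ (1 - q)⁻¹ ∧ (‖(μ - l) • R h‖ ≤ q →
      (1 + (μ - l) • R h) * V = 1 ∧ V * (1 + (μ - l) • R h) = 1) := by
    intro h
    by_cases hh : ‖(μ - l) • R h‖ ≤ q
    · obtain ⟨V, h1, h2, h3⟩ := exists_inverse_one_add hh hq
      exact ⟨V, h3, fun _ => ⟨h1, h2⟩⟩
    · exact ⟨0, by rw [norm_zero, inv_nonneg]; linarith, fun h' => absurd h' hh⟩
  choose V hVn hV using hex
  refine ⟨fun h => R h * V h, ⟨M * (1 - q)⁻¹, fun h hh => ?_⟩, ?_, ?_⟩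
  · exact (norm_mul_le _ _).trans
      (mul_le_mul (hM h hh) (hVn h) (norm_nonneg _) ((norm_nonneg _).trans (hM h hh)))
  · refine squeeze_zero' (Eventually.of_forall fun _ => norm_nonneg _) ?_
      (by simpa using hr.mul_const (1 - q)⁻¹)
    filter_upwards [hle] with h hh
    have key : (μ • (1 : X →L[ℂ] X) - S h) * (R h * V h) - 1 =
        ((l • (1 : X →L[ℂ] X) - S h) * R h - 1) * V h := by
      refine (congrArg (_ - ·) (hV h hh).1.symm).trans ?_
      simp only [sub_mul, add_mul, smul_mul_assoc, one_mul, sub_smul, mul_assoc]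
      abel
    rw [key]
    exact (norm_mul_le _ _).trans (mul_le_mul_of_nonneg_left (hVn h) (norm_nonneg _))
  · refine squeeze_zero' (Eventually.of_forall fun _ => norm_nonneg _) ?_
      (by simpa using hl.const_mul (1 - q)⁻¹)
    filter_upwards [hle] with h hh
    obtain ⟨h1, h2⟩ := hV h hh
    have hcomm : R h * V h = V h * R h := by
      have hc : R h * (1 + (μ - l) • R h) = (1 + (μ - l) • R h) * R h := by
        simp [mul_add, add_mul]
      calc R h * V h = V h * (1 + (μ - l) • R h) * R h * V h := by rw [h2, one_mul]
        _ = V h * R h * ((1 + (μ - l) • R h) * V h) := by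
          rw [mul_assoc (V h), ← hc]; simp only [mul_assoc]
        _ = V h * R h := by rw [h1, mul_one]
    have key : R h * V h * (μ • (1 : X →L[ℂ] X) - S h) - 1 =
        V h * (R h * (l • (1 : X →L[ℂ] X) - S h) - 1) := by
      rw [hcomm]
      refine (congrArg (_ - ·) h2.symm).trans ?_
      simp only [mul_sub, mul_add, mul_smul_comm, mul_one, sub_smul, mul_assoc]
      abel
    rw [key]
    exact (norm_mul_le _ _).trans (mul_le_mul_of_nonneg_right (hVn h) (norm_nonneg _))

theorem stmt3 {X : Type*} [NormedAddCommGroup X] [NormedSpace ℂ X] [CompleteSpace X]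
    (S : ℝ → X →L[ℂ] X) (hS : BddFamily S) :
    IsOpen (famResolvent S) ∧
      ∀ l ∈ famResolvent S, ∀ R : ℝ → X →L[ℂ] X, IsAsympResolvent S R l →
        ∀ μ : ℂ, ‖μ - l‖ * Filter.limsup (fun h => ‖R h‖) zeroFilter < 1 →
          μ ∈ famResolvent S := by
  constructor
  · rw [Metric.isOpen_iff]
    rintro l ⟨R, hR⟩
    obtain ⟨M, hM⟩ := hR.1
    have hpos : 0 < 2 * (|M| + 1) := by positivity
    refine ⟨(2 * (|M| + 1))⁻¹, inv_pos.2 hpos, fun μ hμ => ?_⟩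
    rw [mem_ball_iff_norm] at hμ
    refine hR.mem_famResolvent_of_eventually_le (q := 1 / 2) (by norm_num)
      (eventually_zeroFilter_of_forall fun h hh => ?_)
    have hRh : ‖R h‖ ≤ |M| + 1 := by linarith [hM h hh, le_abs_self M]
    calc ‖(μ - l) • R h‖ = ‖μ - l‖ * ‖R h‖ := norm_smul _ _
      _ ≤ (2 * (|M| + 1))⁻¹ * (|M| + 1) :=
        mul_le_mul hμ.le hRh (norm_nonneg _) (inv_pos.2 hpos).le
      _ = 1 / 2 := by
        have : |M| + 1 ≠ 0 := by positivity
        field_simp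
  · intro l hl R hR μ hμ
    rcases eq_or_ne μ l with rfl | hne
    · exact hl
    have hd : 0 < ‖μ - l‖ := norm_pos_iff.2 (sub_ne_zero.2 hne)
    obtain ⟨q, hq, hq1⟩ := exists_between hμ
    obtain ⟨M, hM⟩ := hR.1
    have hbdd : zeroFilter.IsBoundedUnder (· ≤ ·) fun h => ‖R h‖ :=
      ⟨M, eventually_map.2 (eventually_zeroFilter_of_forall hM)⟩
    refine hR.mem_famResolvent_of_eventually_le hq1 ?_
    filter_upwards [eventually_lt_of_limsup_lt ((lt_div_iff₀' hd).2 hq) hbdd] with h hh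
    rw [norm_smul]
    exact ((lt_div_iff₀' hd).1 hh).le
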